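/- (Quadratic exactness of linear RK.) For every grid vector h and every multi-index α with |α| = 2, the RK interpolant of the monomial y ↦ y^α satisfies Π^h(y ↦ y^α)(x) = x^α + c_α for all x ∈ ℝ^d, where c_α = h_j²/3 if α = 2e_j for some coordinate direction j, and c_α = 0 if α = e_i + e_j with i ≠ j. Consequently, for q(x) := |x|² = Σ_j x_j², one has Π^h q = q + Σ_{j=1}^d h_j²/3, and hence L_δ(Π^h q)(x) = L_δ q(x) for every δ > 0 and every x ∈ ℝ^d. -/

import Mathlib

open MeasureTheory Real
open scoped BigOperators

noncomputable section

/-- The cubic B-spline window function. -/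
def phi (x : ℝ) : ℝ :=
  if x ≤ 1/2 then 2/3 - 4*x^2 + 4*x^3
  else if x ≤ 1 then (4/3)*(1-x)^3
  else 0

/-- Grid point `x_k = (k₁h₁, …, k_d h_d)`. -/
def gridPt (d : ℕ) (h : Fin d → ℝ) (k : Fin d → ℤ) : EuclideanSpace ℝ (Fin d) :=
  (EuclideanSpace.equiv (Fin d) ℝ).symm (fun j => (k j : ℝ) * h j)

/-- Linear RK basis function `Ψ_k`. -/
def Psi (d : ℕ) (h : Fin d → ℝ) (k : Fin d → ℤ) (x : EuclideanSpace ℝ (Fin d)) : ℝ :=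
  ∏ j, phi (|x j - (k j : ℝ) * h j| / (2 * h j))

/-- The RK interpolant `Π^h u`. -/
def RKinterp (d : ℕ) (h : Fin d → ℝ) (u : EuclideanSpace ℝ (Fin d) → ℝ)
    (x : EuclideanSpace ℝ (Fin d)) : ℝ :=
  ∑' k : Fin d → ℤ, Psi d h k x * u (gridPt d h k)

/-- The rescaled kernel `ρ_δ(r) = δ^{-(d+2)} ρ(r/δ)`. -/
def rhoScaled (d : ℕ) (ρ : ℝ → ℝ) (δ : ℝ) (r : ℝ) : ℝ :=
  (δ ^ (d + 2))⁻¹ * ρ (r / δ)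

/-- The nonlocal diffusion operator `L_δ`. -/
def nonlocalOp (d : ℕ) (ρ : ℝ → ℝ) (δ : ℝ) (u : EuclideanSpace ℝ (Fin d) → ℝ)
    (x : EuclideanSpace ℝ (Fin d)) : ℝ :=
  ∫ s in Metric.ball (0 : EuclideanSpace ℝ (Fin d)) δ,
    rhoScaled d ρ δ ‖s‖ * (u (x + s) - u x)

/-- support box -/
def boxS (t h : ℝ) : Finset ℤ := Finset.Icc (⌊t / h⌋ - 1) (⌊t / h⌋ + 2)

lemma w_eq (t h : ℝ) (hh : 0 < h) (k : ℤ) :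
    phi (|t - (k : ℝ) * h| / (2 * h)) = phi (|t / h - k| / 2) := by
  have : t - (k : ℝ) * h = (t / h - k) * h := by field_simp
  rw [this, abs_mul, abs_of_pos hh]
  congr 1
  field_simp

lemma phi_zero (x : ℝ) (hx : 1 ≤ x) : phi x = 0 := by
  unfold phi
  rcases eq_or_lt_of_le hx with rfl | hx
  · norm_num
  · rw [if_neg (by linarith), if_neg (by linarith)]

lemma w_zero (t h : ℝ) (hh : 0 < h) (k : ℤ) (hk : k ∉ boxS t h) :
    phi (|t - (k : ℝ) * h| / (2 * h)) = 0 := by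
  rw [w_eq t h hh]
  apply phi_zero
  have h1 := Int.floor_le (t / h)
  have h2 := Int.lt_floor_add_one (t / h)
  simp only [boxS, Finset.mem_Icc, not_and_or, not_le] at hk
  rcases hk with hk | hk
  · have : (k : ℝ) + 2 ≤ (⌊t / h⌋ : ℝ) := by exact_mod_cast (by omega : k + 2 ≤ ⌊t / h⌋)
    have := le_abs_self (t / h - k)
    linarith
  · have : (⌊t / h⌋ : ℝ) + 3 ≤ k := by exact_mod_cast (by omega : ⌊t / h⌋ + 3 ≤ k)
    have := neg_le_abs (t / h - k)
    linarith

lemma phi_lo (x : ℝ) (hx : x ≤ 1/2) : phi x = 2/3 - 4*x^2 + 4*x^3 := by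
  unfold phi; rw [if_pos hx]

lemma phi_hi (x : ℝ) (hx : 1/2 ≤ x) (hx1 : x ≤ 1) : phi x = (4/3)*(1-x)^3 := by
  rcases eq_or_lt_of_le hx with rfl | hx
  · unfold phi; norm_num
  · unfold phi; rw [if_neg (by linarith), if_pos hx1]

lemma sum_box (t h : ℝ) (hh : 0 < h) (g : ℝ → ℝ) :
    ∃ n f : ℝ, t = (n + f) * h ∧
    ∑ k ∈ boxS t h, phi (|t - (k : ℝ) * h| / (2 * h)) * g ((k : ℝ) * h) =
      (1 - f)^3 / 6 * g ((n - 1) * h) + (2/3 - f^2 + f^3/2) * g (n * h)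
      + (2/3 - (1-f)^2 + (1-f)^3/2) * g ((n+1) * h) + f^3/6 * g ((n+2) * h) := by
  have h1 := Int.floor_le (t / h)
  have h2 := Int.lt_floor_add_one (t / h)
  refine ⟨⌊t / h⌋, t / h - ⌊t / h⌋, by field_simp; ring, ?_⟩
  have hS : boxS t h = {⌊t / h⌋ - 1, ⌊t / h⌋, ⌊t / h⌋ + 1, ⌊t / h⌋ + 2} := by
    ext k; simp only [boxS, Finset.mem_Icc, Finset.mem_insert, Finset.mem_singleton]; omega
  simp_rw [w_eq t h hh]
  rw [hS, Finset.sum_insert (by simp; omega), Finset.sum_insert (by simp),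
    Finset.sum_insert (by simp), Finset.sum_singleton]
  push_cast
  generalize (⌊t / h⌋ : ℝ) = n at *
  generalize t / h = u at *
  rw [abs_of_nonneg (by linarith : 0 ≤ u - (n - 1)), abs_of_nonneg (by linarith : 0 ≤ u - n),
    abs_of_nonpos (by linarith : u - (n + 1) ≤ 0), abs_of_nonpos (by linarith : u - (n + 2) ≤ 0),
    phi_hi _ (by linarith) (by linarith), phi_lo _ (by linarith), phi_lo _ (by linarith),
    phi_hi _ (by linarith) (by linarith)]
  ring

lemma sum_one (t h : ℝ) (hh : 0 < h) :
    ∑ k ∈ boxS t h, phi (|t - (k : ℝ) * h| / (2 * h)) = 1 := by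
  obtain ⟨n, f, ht, e⟩ := sum_box t h hh (fun _ => 1)
  simp only [mul_one] at e
  rw [e]; ring

lemma sum_id (t h : ℝ) (hh : 0 < h) :
    ∑ k ∈ boxS t h, phi (|t - (k : ℝ) * h| / (2 * h)) * ((k : ℝ) * h) = t := by
  obtain ⟨n, f, ht, e⟩ := sum_box t h hh (fun y => y)
  rw [e]; conv_rhs => rw [ht]
  ring

lemma sum_sq (t h : ℝ) (hh : 0 < h) :
    ∑ k ∈ boxS t h, phi (|t - (k : ℝ) * h| / (2 * h)) * ((k : ℝ) * h)^2 = t^2 + h^2/3 := by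
  obtain ⟨n, f, ht, e⟩ := sum_box t h hh (fun y => y^2)
  rw [e]; conv_rhs => rw [ht]
  ring

lemma gridPt_apply (d : ℕ) (h : Fin d → ℝ) (k : Fin d → ℤ) (j : Fin d) :
    gridPt d h k j = (k j : ℝ) * h j := rfl

lemma RK_fin (d : ℕ) (h : Fin d → ℝ) (hpos : ∀ j, 0 < h j) (u : EuclideanSpace ℝ (Fin d) → ℝ)
    (x : EuclideanSpace ℝ (Fin d)) :
    RKinterp d h u x = ∑ k ∈ Fintype.piFinset (fun j => boxS (x j) (h j)),
      Psi d h k x * u (gridPt d h k) := by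
  unfold RKinterp
  apply tsum_eq_sum
  intro k hk
  simp only [Fintype.mem_piFinset, not_forall] at hk
  obtain ⟨j, hj⟩ := hk
  have : Psi d h k x = 0 :=
    Finset.prod_eq_zero (Finset.mem_univ j) (w_zero _ _ (hpos j) _ hj)
  rw [this, zero_mul]

lemma RK_prod (d : ℕ) (h : Fin d → ℝ) (hpos : ∀ j, 0 < h j) (g : Fin d → ℝ → ℝ)
    (x : EuclideanSpace ℝ (Fin d)) :
    RKinterp d h (fun y => ∏ j, g j (y j)) x = ∏ j, ∑ k ∈ boxS (x j) (h j),
      phi (|x j - (k : ℝ) * h j| / (2 * h j)) * g j ((k : ℝ) * h j) := by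
  rw [RK_fin d h hpos, Finset.prod_univ_sum]
  refine Finset.sum_congr rfl fun k _ => ?_
  rw [Psi, ← Finset.prod_mul_distrib]
  rfl

lemma RK_sq (d : ℕ) (h : Fin d → ℝ) (hpos : ∀ j, 0 < h j) (j : Fin d)
    (x : EuclideanSpace ℝ (Fin d)) :
    RKinterp d h (fun y => (y j)^2) x = (x j)^2 + (h j)^2 / 3 := by
  have e := RK_prod d h hpos (fun i t => if i = j then t^2 else 1) x
  simp only [Finset.prod_ite_eq', Finset.mem_univ, if_true] at e
  rw [e, Finset.prod_eq_single j]
  · simp only [if_true]; exact sum_sq _ _ (hpos j)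
  · intro i _ hi
    simp only [hi, if_false, mul_one]; exact sum_one _ _ (hpos i)
  · simp

lemma RK_mix (d : ℕ) (h : Fin d → ℝ) (hpos : ∀ j, 0 < h j) (i j : Fin d) (hij : i ≠ j)
    (x : EuclideanSpace ℝ (Fin d)) :
    RKinterp d h (fun y => y i * y j) x = x i * x j := by
  have key : ∀ y : Fin d → ℝ, (∏ m, if m = i ∨ m = j then y m else 1) = y i * y j := by
    intro y
    rw [Finset.prod_eq_mul i j hij]
    · simp
    · intro m _ hm; simp [hm.1, hm.2]
    · simp
    · simp
  have e := RK_prod d h hpos (fun m t => if m = i ∨ m = j then t else 1) x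
  have e1 : (fun y : EuclideanSpace ℝ (Fin d) => y i * y j) =
      fun y => ∏ m, if m = i ∨ m = j then y m else 1 := by
    funext y; exact (key (fun m => y m)).symm
  rw [e1, e, ← key (fun m => x m)]
  refine Finset.prod_congr rfl fun m _ => ?_
  by_cases hm : m = i ∨ m = j
  · simp only [hm, if_true]; exact sum_id _ _ (hpos m)
  · simp only [hm, if_false, mul_one]; exact sum_one _ _ (hpos m)

lemma RK_q (d : ℕ) (h : Fin d → ℝ) (hpos : ∀ j, 0 < h j)
    (x : EuclideanSpace ℝ (Fin d)) :
    RKinterp d h (fun y => ∑ j, (y j)^2) x = (∑ j, (x j)^2) + ∑ j, (h j)^2 / 3 := by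
  rw [RK_fin d h hpos, ← Finset.sum_add_distrib]
  simp_rw [Finset.mul_sum]
  rw [Finset.sum_comm]
  refine Finset.sum_congr rfl fun j _ => ?_
  rw [← RK_sq d h hpos j x, RK_fin d h hpos]

/-- Quadratic exactness of linear RK: the RK interpolant shifts quadratic
monomials by the constants `c_α`, reproduces `|x|²` up to the constant `Σ_j h_j²/3`,
and hence `L_δ(Π^h q) = L_δ q` for `q(x) = |x|²`. -/
theorem rk_quadratic_exactness (d : ℕ) (hd : 1 ≤ d) (ρ : ℝ → ℝ)
    (hρ_nonneg : ∀ r, 0 ≤ ρ r)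
    (hρ_mono : ∀ r₁ r₂, 0 ≤ r₁ → r₁ ≤ r₂ → ρ r₂ ≤ ρ r₁)
    (hρ_supp : ∀ r, 1 < r → ρ r = 0)
    (hρ_mom2 : ∫ s in Metric.ball (0 : EuclideanSpace ℝ (Fin d)) 1,
        ρ ‖s‖ * ‖s‖^2 = 2 * d)
    (hρ_mom1 : IntegrableOn (fun s : EuclideanSpace ℝ (Fin d) => ρ ‖s‖ * ‖s‖)
        (Metric.ball 0 1))
    (h : Fin d → ℝ) (hpos : ∀ j, 0 < h j) :
    (∀ j : Fin d, ∀ x, RKinterp d h (fun y => (y j)^2) x = (x j)^2 + (h j)^2 / 3) ∧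
    (∀ i j : Fin d, i ≠ j → ∀ x, RKinterp d h (fun y => y i * y j) x = x i * x j) ∧
    (∀ x, RKinterp d h (fun y => ∑ j, (y j)^2) x =
        (∑ j, (x j)^2) + ∑ j, (h j)^2 / 3) ∧
    (∀ δ : ℝ, 0 < δ → ∀ x,
      nonlocalOp d ρ δ (RKinterp d h (fun y => ∑ j, (y j)^2)) x =
        nonlocalOp d ρ δ (fun y => ∑ j, (y j)^2) x) := by
  refine ⟨fun j x => RK_sq d h hpos j x, fun i j hij x => RK_mix d h hpos i j hij x,
    fun x => RK_q d h hpos x, fun δ _ x => ?_⟩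
  unfold nonlocalOp
  simp only [RK_q d h hpos, add_sub_add_right_eq_sub]

end
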